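/- Let G be a group, and let Z and U be nonzero rings such that the group ring ZG is a subring of U and every nonzero element of ZG is invertible in U. Then the following are equivalent: (a) G can be generated by two elements and H₁(G; U) is isomorphic to U as a left U-module; (b) G can be generated by two elements and H₁(G; U) ≠ 0; (c) G is a free group of rank two. -/

import Mathlib

/-- The augmentation ring homomorphism `ZG → Z`, sending each group element
to `1`. -/
noncomputable def augmentationRingHom (Z : Type) [Ring Z] (G : Type) [Group G] :
    MonoidAlgebra Z G →+* Z :=
  MonoidAlgebra.liftNCRingHom (RingHom.id Z) 1 (fun _ _ => Commute.one_right _)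

/-- The trivial left `ZG`-module `Z`: `Z` with each element of `G` acting as
the identity, i.e. with the `ZG`-action given by the augmentation. -/
def TrivialModule (Z : Type) [Ring Z] (G : Type) [Group G] : Type := Z

instance (Z : Type) [Ring Z] (G : Type) [Group G] :
    AddCommGroup (TrivialModule Z G) :=
  inferInstanceAs (AddCommGroup Z)

noncomputable instance (Z : Type) [Ring Z] (G : Type) [Group G] :
    Module (MonoidAlgebra Z G) (TrivialModule Z G) :=
  Module.compHom Z (augmentationRingHom Z G)

/-- The augmentation `ZG → Z` as a map of left `ZG`-modules onto the trivial
module. -/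
noncomputable def augmentationLinearMap (Z : Type) [Ring Z] (G : Type) [Group G] :
    MonoidAlgebra Z G →ₗ[MonoidAlgebra Z G] TrivialModule Z G where
  toFun x := (augmentationRingHom Z G x : TrivialModule Z G)
  map_add' x y := map_add _ x y
  map_smul' a x := by
    show augmentationRingHom Z G (a * x) =
      augmentationRingHom Z G a • augmentationRingHom Z G x
    rw [map_mul]
    rfl

/-- `b : U → M → T` realizes the base-changed module `U ⊗_{ZG} M` (for `U` a
ring containing the image of `A = ZG` under `φ`, `M` a left `A`-module and `T`
a left `U`-module): `b` is biadditive, `A`-balanced and `U`-linear in the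
first variable, and is universal among such maps into left `U`-modules. -/
def IsInducedTensor {A U : Type} [Ring A] [Ring U] (φ : A →+* U)
    {M : Type} [AddCommGroup M] [Module A M]
    {T : Type} [AddCommGroup T] [Module U T] (b : U → M → T) : Prop :=
  (∀ u u' m, b (u + u') m = b u m + b u' m) ∧
  (∀ u m m', b u (m + m') = b u m + b u m') ∧
  (∀ u a m, b (u * φ a) m = b u (a • m)) ∧
  (∀ u' u m, b (u' * u) m = u' • b u m) ∧
  ∀ (T' : Type) (_ : AddCommGroup T') (_ : Module U T') (b' : U → M → T'),
    (∀ u u' m, b' (u + u') m = b' u m + b' u' m) →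
    (∀ u m m', b' u (m + m') = b' u m + b' u m') →
    (∀ u a m, b' (u * φ a) m = b' u (a • m)) →
    (∀ u' u m, b' (u' * u) m = u' • b' u m) →
    ∃! g : T →ₗ[U] T', ∀ u m, g (b u m) = b' u m

/-- `H1OfResolutionPred G Z U φ Pr` says: for every projective resolution
`⋯ → P₁ → P₀ → Z → 0` of the trivial left `ZG`-module `Z`, and every
realization `T_k = U ⊗_{ZG} P_k` of the base-changed complex (with induced
maps `D_k`), the first homology `H₁(G; U) = ker D₀ / im D₁` satisfies the
predicate `Pr`. -/
def H1OfResolutionPred (G Z U : Type) [Group G] [Ring Z] [Ring U]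
    (φ : MonoidAlgebra Z G →+* U)
    (Pr : (M : Type) → [AddCommGroup M] → [Module U M] → Prop) : Prop :=
  ∀ (P : ℕ → Type) (_ : ∀ k, AddCommGroup (P k))
    (_ : ∀ k, Module (MonoidAlgebra Z G) (P k)),
    (∀ k, Module.Projective (MonoidAlgebra Z G) (P k)) →
    ∀ (d : ∀ k, P (k + 1) →ₗ[MonoidAlgebra Z G] P k)
      (ε : P 0 →ₗ[MonoidAlgebra Z G] TrivialModule Z G),
      Function.Surjective ε → Function.Exact (d 0) ε →
      (∀ k, Function.Exact (d (k + 1)) (d k)) →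
    ∀ (T : ℕ → Type) (_ : ∀ k, AddCommGroup (T k)) (_ : ∀ k, Module U (T k))
      (b : ∀ k, U → P k → T k), (∀ k, IsInducedTensor φ (b k)) →
    ∀ (D : ∀ k, T (k + 1) →ₗ[U] T k),
      (∀ k u p, D k (b (k + 1) u p) = b k u (d k p)) →
    Pr (↥(LinearMap.ker (D 0)) ⧸
        Submodule.comap (LinearMap.ker (D 0)).subtype (LinearMap.range (D 1)))

open Function

section InducedTensor

variable {A U : Type} [Ring A] [Ring U] {φ : A →+* U}
  {M N : Type} [AddCommGroup M] [Module A M] [AddCommGroup N] [Module A N]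
  {S T : Type} [AddCommGroup S] [Module U S] [AddCommGroup T] [Module U T]
  {b : U → M → S} {c : U → N → T}

namespace IsInducedTensor

theorem smul_one (hb : IsInducedTensor φ b) (u : U) (m : M) : b u m = u • b 1 m := by
  rw [← hb.2.2.2.1, mul_one]

theorem map_zero (hb : IsInducedTensor φ b) (u : U) : b u 0 = 0 := by
  simpa using hb.2.1 u 0 0

theorem map_sub (hb : IsInducedTensor φ b) (u : U) (m m' : M) :
    b u (m - m') = b u m - b u m' := by
  rw [eq_sub_iff_add_eq, ← hb.2.1, sub_add_cancel]

/-- Linear maps out of an induced module are determined by their values on pure tensors. -/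
theorem hom_ext (hb : IsInducedTensor φ b) {f g : S →ₗ[U] T}
    (h : ∀ u m, f (b u m) = g (b u m)) : f = g := by
  obtain ⟨h₁, h₂, h₃, h₄, huniv⟩ := hb
  refine (huniv T _ _ (fun u m => g (b u m)) ?_ ?_ ?_ ?_).unique h fun _ _ => rfl
  · intro u u' m; rw [h₁, _root_.map_add]
  · intro u m m'; rw [h₂, _root_.map_add]
  · intro u a m; rw [h₃]
  · intro u' u m; rw [h₄, map_smul]

theorem map_mem (hb : IsInducedTensor φ b) (f : S →ₗ[U] T) (K : Submodule U T)
    (h : ∀ m, f (b 1 m) ∈ K) (s : S) : f s ∈ K := by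
  have h0 : K.mkQ ∘ₗ f = 0 := hb.hom_ext fun u m => by
    rw [hb.smul_one u m, map_smul, LinearMap.comp_apply, K.mkQ_apply,
      (Submodule.Quotient.mk_eq_zero K).2 (h m), smul_zero, LinearMap.zero_apply]
  simpa using LinearMap.congr_fun h0 s

/-- Functoriality of induction. -/
theorem exists_map (hb : IsInducedTensor φ b) (hc : IsInducedTensor φ c) (f : M →ₗ[A] N) :
    ∃ F : S →ₗ[U] T, ∀ u m, F (b u m) = c u (f m) := by
  obtain ⟨h₁, h₂, h₃, h₄, -⟩ := hc
  refine (hb.2.2.2.2 T _ _ (fun u m => c u (f m)) ?_ ?_ ?_ ?_).exists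
  · intro u u' m; exact h₁ _ _ _
  · intro u m m'; simp only [_root_.map_add, h₂]
  · intro u a m; simp only [h₃, map_smul]
  · intro u' u m; exact h₄ _ _ _

end IsInducedTensor

/-- The submodule of `U ⊗ M` generated by the kernel of `d : M → N`. -/
def kernelSpan (b : U → M → S) (d : M →ₗ[A] N) : Submodule U S :=
  Submodule.span U (b 1 '' (LinearMap.ker d : Set M))

theorem mem_kernelSpan (b : U → M → S) {d : M →ₗ[A] N} {m : M} (hm : d m = 0) :
    b 1 m ∈ kernelSpan b d :=
  Submodule.subset_span ⟨m, hm, rfl⟩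

theorem range_eq_kernelSpan (hb : IsInducedTensor φ b)
    {L : Type} [AddCommGroup L] [Module A L] {e : M →ₗ[A] N} {d : N →ₗ[A] L}
    (hed : Exact e d) {E : S →ₗ[U] T} (hE : ∀ u m, E (b u m) = c u (e m)) :
    LinearMap.range E = kernelSpan c d := by
  apply le_antisymm
  · rintro _ ⟨s, rfl⟩
    exact hb.map_mem E _ (fun m => by
      rw [hE]; exact mem_kernelSpan c (hed.apply_apply_eq_zero m)) s
  · rw [kernelSpan, Submodule.span_le]
    rintro _ ⟨n, hn, rfl⟩
    obtain ⟨m, rfl⟩ := (hed n).1 hn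
    exact ⟨b 1 m, hE 1 m⟩

/-- The relative homology `ker (U ⊗ d) / U · ker d`; for the first differential `d` of a
projective resolution this is the first homology with coefficients in `U`. -/
abbrev KernelQuotient (b : U → M → S) (d : M →ₗ[A] N) (D : S →ₗ[U] T) : Type :=
  ↥(LinearMap.ker D) ⧸ Submodule.comap (LinearMap.ker D).subtype (kernelSpan b d)

end InducedTensor

section Comparison

theorem exists_lift_of_exact {A : Type} [Ring A] {P L N K : Type}
    [AddCommGroup P] [Module A P] [AddCommGroup L] [Module A L]
    [AddCommGroup N] [Module A N] [AddCommGroup K] [Module A K] [Module.Projective A P]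
    {h : L →ₗ[A] N} {k : N →ₗ[A] K} (hk : Exact h k) (f : P →ₗ[A] N) (hf : k ∘ₗ f = 0) :
    ∃ g : P →ₗ[A] L, h ∘ₗ g = f := by
  have hr : ∀ p, f p ∈ LinearMap.range h := fun p => (hk _).1 (LinearMap.congr_fun hf p)
  obtain ⟨g, hg⟩ := Module.projective_lifting_property h.rangeRestrict
    (f.codRestrict _ hr) h.surjective_rangeRestrict
  refine ⟨g, LinearMap.ext fun p => ?_⟩
  simpa using congrArg Subtype.val (LinearMap.congr_fun hg p)

variable {A U : Type} [Ring A] [Ring U] {φ : A →+* U}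
  {X P₀ P₁ Q₀ Q₁ : Type} [AddCommGroup X] [Module A X]
  [AddCommGroup P₀] [Module A P₀] [AddCommGroup P₁] [Module A P₁]
  [AddCommGroup Q₀] [Module A Q₀] [AddCommGroup Q₁] [Module A Q₁]
  {S₀ S₁ T₀ T₁ : Type} [AddCommGroup S₀] [Module U S₀] [AddCommGroup S₁] [Module U S₁]
  [AddCommGroup T₀] [Module U T₀] [AddCommGroup T₁] [Module U T₁]
  {b₀ : U → P₀ → S₀} {b₁ : U → P₁ → S₁} {c₀ : U → Q₀ → T₀} {c₁ : U → Q₁ → T₁}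
  {d : P₁ →ₗ[A] P₀} {ε : P₀ →ₗ[A] X} {e : Q₁ →ₗ[A] Q₀} {η : Q₀ →ₗ[A] X}
  {D : S₁ →ₗ[U] S₀} {E : T₁ →ₗ[U] T₀}

theorem sub_mem_kernelSpan [Module.Projective A P₀]
    (hb₀ : IsInducedTensor φ b₀) (hb₁ : IsInducedTensor φ b₁)
    (hd : Exact d ε) (hD : ∀ u p, D (b₁ u p) = b₀ u (d p))
    {f₀ : P₀ →ₗ[A] P₀} {f₁ : P₁ →ₗ[A] P₁} (h₀ : ε ∘ₗ f₀ = ε) (h₁ : d ∘ₗ f₁ = f₀ ∘ₗ d)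
    {F : S₁ →ₗ[U] S₁} (hF : ∀ u p, F (b₁ u p) = b₁ u (f₁ p)) {s : S₁} (hs : D s = 0) :
    s - F s ∈ kernelSpan b₁ d := by
  obtain ⟨h, hh⟩ := exists_lift_of_exact hd (LinearMap.id - f₀)
    (by rw [LinearMap.comp_sub, h₀, LinearMap.comp_id, sub_self])
  obtain ⟨H, hH⟩ := hb₀.exists_map hb₁ h
  have key := hb₁.map_mem (LinearMap.id - F - H ∘ₗ D : S₁ →ₗ[U] S₁) (kernelSpan b₁ d)
    (fun p => ?_) s
  · simpa [hs] using key
  · have : (LinearMap.id - F - H ∘ₗ D : S₁ →ₗ[U] S₁) (b₁ 1 p) = b₁ 1 (p - f₁ p - h (d p)) := by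
      simp [hF, hD, hH, hb₁.map_sub]
    rw [this]
    apply mem_kernelSpan
    have e₁ := LinearMap.congr_fun hh (d p)
    have e₂ := LinearMap.congr_fun h₁ p
    simp only [LinearMap.comp_apply, LinearMap.sub_apply, LinearMap.id_apply] at e₁ e₂
    rw [map_sub, map_sub, e₁, e₂]
    abel

theorem map_mem_kernelSpan {f₀ : P₀ →ₗ[A] Q₀} {f₁ : P₁ →ₗ[A] Q₁}
    (h₁ : e ∘ₗ f₁ = f₀ ∘ₗ d) {F : S₁ →ₗ[U] T₁} (hF : ∀ u p, F (b₁ u p) = c₁ u (f₁ p)) :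
    kernelSpan b₁ d ≤ (kernelSpan c₁ e).comap F := by
  rw [kernelSpan, Submodule.span_le]
  rintro _ ⟨p, hp, rfl⟩
  rw [SetLike.mem_coe, Submodule.mem_comap, hF]
  apply mem_kernelSpan
  have := LinearMap.congr_fun h₁ p
  simp only [LinearMap.comp_apply, LinearMap.mem_ker.1 hp, map_zero] at this
  exact this

theorem map_mem_ker (hb₀ : IsInducedTensor φ b₀) (hb₁ : IsInducedTensor φ b₁)
    (hc₀ : IsInducedTensor φ c₀)
    (hD : ∀ u p, D (b₁ u p) = b₀ u (d p)) (hE : ∀ u q, E (c₁ u q) = c₀ u (e q))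
    {f₀ : P₀ →ₗ[A] Q₀} {f₁ : P₁ →ₗ[A] Q₁}
    (h₁ : e ∘ₗ f₁ = f₀ ∘ₗ d) {F : S₁ →ₗ[U] T₁} (hF : ∀ u p, F (b₁ u p) = c₁ u (f₁ p)) :
    ∀ s ∈ LinearMap.ker D, F s ∈ LinearMap.ker E := by
  obtain ⟨F₀, hF₀⟩ := hb₀.exists_map hc₀ f₀
  have h : E ∘ₗ F = F₀ ∘ₗ D := hb₁.hom_ext fun u p => by
    simpa [hF, hE, hD, hF₀] using congrArg (c₀ u) (LinearMap.congr_fun h₁ p)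
  intro s hs
  have := LinearMap.congr_fun h s
  simpa [LinearMap.mem_ker.1 hs] using this

/-- The quotient `ker (U ⊗ d) / U · ker d` does not depend on the projective presentation. -/
theorem nonempty_kernelQuotient_equiv [Module.Projective A P₀] [Module.Projective A P₁]
    [Module.Projective A Q₀] [Module.Projective A Q₁]
    (hb₀ : IsInducedTensor φ b₀) (hb₁ : IsInducedTensor φ b₁)
    (hc₀ : IsInducedTensor φ c₀) (hc₁ : IsInducedTensor φ c₁)
    (hε : Surjective ε) (hη : Surjective η) (hd : Exact d ε) (he : Exact e η)
    (hD : ∀ u p, D (b₁ u p) = b₀ u (d p)) (hE : ∀ u q, E (c₁ u q) = c₀ u (e q)) :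
    Nonempty (KernelQuotient b₁ d D ≃ₗ[U] KernelQuotient c₁ e E) := by
  obtain ⟨g₀, hg₀⟩ := Module.projective_lifting_property η ε hη
  obtain ⟨f₀, hf₀⟩ := Module.projective_lifting_property ε η hε
  obtain ⟨g₁, hg₁⟩ := exists_lift_of_exact he (g₀ ∘ₗ d)
    (by rw [← LinearMap.comp_assoc, hg₀, hd.linearMap_comp_eq_zero])
  obtain ⟨f₁, hf₁⟩ := exists_lift_of_exact hd (f₀ ∘ₗ e)
    (by rw [← LinearMap.comp_assoc, hf₀, he.linearMap_comp_eq_zero])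
  obtain ⟨α, hα⟩ := hb₁.exists_map hc₁ g₁
  obtain ⟨β, hβ⟩ := hc₁.exists_map hb₁ f₁
  refine ⟨LinearEquiv.ofLinearMap
    (Submodule.mapQ _ _ (α.restrict (map_mem_ker hb₀ hb₁ hc₀ hD hE hg₁ hα))
      fun s hs => map_mem_kernelSpan hg₁ hα hs)
    (Submodule.mapQ _ _ (β.restrict (map_mem_ker hc₀ hc₁ hb₀ hE hD hf₁ hβ))
      fun s hs => map_mem_kernelSpan hf₁ hβ hs) ?_ ?_⟩
  · refine Submodule.linearMap_qext _ (LinearMap.ext fun s => ?_)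
    refine ((Submodule.Quotient.eq _).2 ?_).symm
    exact sub_mem_kernelSpan hc₀ hc₁ he hE (f₀ := g₀ ∘ₗ f₀) (f₁ := g₁ ∘ₗ f₁)
      (F := α ∘ₗ β) (by rw [← LinearMap.comp_assoc, hg₀, hf₀])
      (by rw [← LinearMap.comp_assoc, hg₁, LinearMap.comp_assoc, hf₁, LinearMap.comp_assoc])
      (by simp [hα, hβ]) s.2
  · refine Submodule.linearMap_qext _ (LinearMap.ext fun s => ?_)
    refine ((Submodule.Quotient.eq _).2 ?_).symm
    exact sub_mem_kernelSpan hb₀ hb₁ hd hD (f₀ := f₀ ∘ₗ g₀) (f₁ := f₁ ∘ₗ g₁)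
      (F := β ∘ₗ α) (by rw [← LinearMap.comp_assoc, hf₀, hg₀])
      (by rw [← LinearMap.comp_assoc, hf₁, LinearMap.comp_assoc, hg₁, LinearMap.comp_assoc])
      (by simp [hα, hβ]) s.2

end Comparison

section FreeModules

variable {A U : Type} [Ring A] [Ring U] (φ : A →+* U)

theorem isInducedTensor_self : IsInducedTensor φ (fun (u : U) (a : A) => u * φ a) := by
  refine ⟨fun _ _ _ => add_mul _ _ _, fun _ _ _ => by simp [mul_add],
    fun _ _ _ => by simp [mul_assoc], fun _ _ _ => by simp [mul_assoc], ?_⟩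
  intro T' _ _ b' h₁ h₂ h₃ h₄
  refine ⟨LinearMap.toSpanSingleton U T' (b' 1 1), fun u a => ?_, fun g hg => ?_⟩
  · simp only [LinearMap.toSpanSingleton_apply]
    rw [← h₄, mul_one, h₃, smul_eq_mul, mul_one]
  · ext
    simpa using hg 1 1

/-- The universal balanced map `U × A^(ι) → U^(ι)`. -/
noncomputable def finsuppInduced (ι : Type) (u : U) (p : ι →₀ A) : ι →₀ U :=
  p.mapRange (fun a => u * φ a) (by simp)

@[simp]
theorem finsuppInduced_apply {ι : Type} (u : U) (p : ι →₀ A) (i : ι) :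
    finsuppInduced φ ι u p i = u * φ (p i) := rfl

@[simp]
theorem finsuppInduced_single {ι : Type} (u : U) (i : ι) (a : A) :
    finsuppInduced φ ι u (Finsupp.single i a) = Finsupp.single i (u * φ a) := by
  simp [finsuppInduced]

theorem isInducedTensor_finsupp (ι : Type) : IsInducedTensor φ (finsuppInduced φ ι) := by
  refine ⟨fun _ _ _ => by ext; simp [add_mul], fun _ _ _ => by ext; simp [mul_add],
    fun _ _ _ => by ext; simp [mul_assoc], fun _ _ _ => by ext; simp [mul_assoc], ?_⟩
  intro T' _ _ b' h₁ h₂ h₃ h₄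
  refine ⟨Finsupp.linearCombination U fun i => b' 1 (Finsupp.single i 1), fun u p => ?_,
    fun g hg => ?_⟩
  · have h0 : b' u 0 = 0 := by simpa using h₂ u 0 0
    induction p using Finsupp.induction_linear with
    | zero => rw [h0]; simp [finsuppInduced]
    | add p q hp hq =>
      rw [h₂, ← hp, ← hq, ← map_add]
      congr 1
      ext
      simp [mul_add]
    | single i a =>
      rw [finsuppInduced_single, Finsupp.linearCombination_single, ← h₄, mul_one, h₃,
        Finsupp.smul_single, smul_eq_mul, mul_one]
  · ext i
    simpa using hg 1 (Finsupp.single i 1)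

/-- The iterated syzygies of `X` for the resolution by free modules on underlying sets. -/
noncomputable def freeSyzygy (X : ModuleCat.{0} A) : ℕ → ModuleCat.{0} A
  | 0 => X
  | k + 1 => ModuleCat.of A
      (LinearMap.ker (Finsupp.linearCombination A (id : freeSyzygy X k → freeSyzygy X k)))

/-- The differential of the resolution by free modules on underlying sets. -/
noncomputable def freeDifferential (X : ModuleCat.{0} A) (k : ℕ) :
    (freeSyzygy X (k + 1) →₀ A) →ₗ[A] (freeSyzygy X k →₀ A) :=
  (LinearMap.ker (Finsupp.linearCombination A
    (id : freeSyzygy X k → freeSyzygy X k))).subtype ∘ₗ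
    Finsupp.linearCombination A (id : freeSyzygy X (k + 1) → freeSyzygy X (k + 1))

theorem surjective_linearCombination_id (M : Type) [AddCommGroup M] [Module A M] :
    Surjective (Finsupp.linearCombination A (id : M → M)) :=
  Finsupp.linearCombination_id_surjective A M

theorem exact_freeDifferential_zero (X : ModuleCat.{0} A) (k : ℕ) :
    Exact (freeDifferential X k)
      (Finsupp.linearCombination A (id : freeSyzygy X k → freeSyzygy X k)) := by
  intro p
  constructor
  · intro hp
    obtain ⟨q, hq⟩ := surjective_linearCombination_id (A := A) (freeSyzygy X (k + 1)) ⟨p, hp⟩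
    exact ⟨q, congrArg Subtype.val hq⟩
  · rintro ⟨q, rfl⟩
    exact (Finsupp.linearCombination A
      (id : freeSyzygy X (k + 1) → freeSyzygy X (k + 1)) q).2

theorem exact_freeDifferential (X : ModuleCat.{0} A) (k : ℕ) :
    Exact (freeDifferential X (k + 1)) (freeDifferential X k) := by
  intro p
  rw [← exact_freeDifferential_zero X (k + 1) p]
  exact Submodule.coe_eq_zero

end FreeModules

section FoxCalculus

variable {ι G Z : Type} [Group G] [Ring Z]

/-- The Fox differential `e i ↦ x i - 1` from the free module on `ι` to the group ring. -/
noncomputable def foxBoundary (Z : Type) [Ring Z] (x : ι → G) :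
    (ι →₀ MonoidAlgebra Z G) →ₗ[MonoidAlgebra Z G] MonoidAlgebra Z G :=
  Finsupp.linearCombination _ fun i => MonoidAlgebra.of Z G (x i) - 1

@[simp]
theorem foxBoundary_single (x : ι → G) (i : ι) (a : MonoidAlgebra Z G) :
    foxBoundary Z x (Finsupp.single i a) = a * (MonoidAlgebra.of Z G (x i) - 1) := by
  rw [foxBoundary, Finsupp.linearCombination_single, smul_eq_mul]

theorem augmentationRingHom_single (g : G) (z : Z) :
    augmentationRingHom Z G (MonoidAlgebra.single g z) = z := by
  simp [augmentationRingHom]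

theorem surjective_augmentationLinearMap : Surjective (augmentationLinearMap Z G) :=
  fun z => ⟨MonoidAlgebra.single (R := Z) 1 z, augmentationRingHom_single (Z := Z) 1 z⟩

theorem of_sub_one_mem_range_foxBoundary {x : ι → G}
    (hx : Subgroup.closure (Set.range x) = ⊤) (g : G) :
    MonoidAlgebra.of Z G g - 1 ∈ LinearMap.range (foxBoundary Z x) := by
  have hg : g ∈ Subgroup.closure (Set.range x) := hx ▸ Subgroup.mem_top g
  induction hg using Subgroup.closure_induction with
  | mem g hg =>
    obtain ⟨i, rfl⟩ := hg
    exact ⟨Finsupp.single i 1, by simp⟩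
  | one => rw [map_one, sub_self]; exact zero_mem _
  | mul g h _ _ hg hh =>
    have : MonoidAlgebra.of Z G (g * h) - 1 = (MonoidAlgebra.of Z G g - 1) +
        MonoidAlgebra.of Z G g • (MonoidAlgebra.of Z G h - 1) := by
      rw [map_mul, smul_eq_mul]; noncomm_ring
    rw [this]
    exact add_mem hg (Submodule.smul_mem _ _ hh)
  | inv g _ hg =>
    have : MonoidAlgebra.of Z G g⁻¹ - 1 =
        -(MonoidAlgebra.of Z G g⁻¹ • (MonoidAlgebra.of Z G g - 1)) := by
      rw [smul_eq_mul, mul_sub, ← map_mul, inv_mul_cancel, map_one, mul_one, neg_sub]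
    rw [this]
    exact neg_mem (Submodule.smul_mem _ _ hg)

theorem augmentationRingHom_eq_zero_iff {x : ι → G}
    (hx : Subgroup.closure (Set.range x) = ⊤) (a : MonoidAlgebra Z G) :
    augmentationRingHom Z G a = 0 ↔ a ∈ LinearMap.range (foxBoundary Z x) := by
  constructor
  · have key : a - MonoidAlgebra.single 1 (augmentationRingHom Z G a) ∈
        LinearMap.range (foxBoundary Z x) := by
      induction a using MonoidAlgebra.induction_linear with
      | zero => simp
      | add a b ha hb =>
        have h := add_mem ha hb
        rwa [sub_add_sub_comm, ← MonoidAlgebra.single_add, ← map_add] at h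
      | single g z =>
        have : MonoidAlgebra.single g z - MonoidAlgebra.single 1 z =
            MonoidAlgebra.single (1 : G) z • (MonoidAlgebra.of Z G g - 1) := by
          rw [smul_eq_mul, mul_sub, mul_one, MonoidAlgebra.of_apply,
            MonoidAlgebra.single_mul_single, one_mul, mul_one]
        rw [augmentationRingHom_single, this]
        exact Submodule.smul_mem _ _ (of_sub_one_mem_range_foxBoundary hx g)
    intro ha
    rwa [ha, MonoidAlgebra.single_zero, sub_zero] at key
  · rintro ⟨p, rfl⟩
    induction p using Finsupp.induction_linear with
    | zero => simp
    | add p q hp hq => rw [map_add, map_add, hp, hq, add_zero]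
    | single i a =>
      rw [foxBoundary_single, map_mul, map_sub, MonoidAlgebra.of_apply,
        augmentationRingHom_single, map_one, sub_self, mul_zero]

theorem exact_foxBoundary {x : ι → G} (hx : Subgroup.closure (Set.range x) = ⊤) :
    Exact (foxBoundary Z x) (augmentationLinearMap Z G) :=
  augmentationRingHom_eq_zero_iff hx

/-- The Fox derivative of a word, with values in the group ring of the target group. -/
noncomputable def foxDerivative (Z : Type) [Ring Z] (x : ι → G) :
    List (ι × Bool) → (ι →₀ MonoidAlgebra Z G)
  | [] => 0
  | (i, true) :: L => Finsupp.single i 1 + MonoidAlgebra.of Z G (x i) • foxDerivative Z x L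
  | (i, false) :: L =>
      MonoidAlgebra.of Z G (x i)⁻¹ • (foxDerivative Z x L - Finsupp.single i 1)

theorem lift_mk_cons (x : ι → G) (p : ι × Bool) (L : List (ι × Bool)) :
    FreeGroup.lift x (FreeGroup.mk (p :: L)) =
      cond p.2 (x p.1) (x p.1)⁻¹ * FreeGroup.lift x (FreeGroup.mk L) := by
  simp [FreeGroup.lift_mk]

/-- The fundamental formula of Fox calculus. -/
theorem foxBoundary_foxDerivative (x : ι → G) (L : List (ι × Bool)) :
    foxBoundary Z x (foxDerivative Z x L) =
      MonoidAlgebra.of Z G (FreeGroup.lift x (FreeGroup.mk L)) - 1 := by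
  induction L with
  | nil => rw [foxDerivative, map_zero, ← FreeGroup.one_eq_mk, map_one, map_one, sub_self]
  | cons p L ih =>
    obtain ⟨i, ε⟩ := p
    cases ε
    · rw [foxDerivative, map_smul, map_sub, ih, foxBoundary_single, lift_mk_cons, cond_false,
        one_mul, sub_sub_sub_cancel_right, smul_eq_mul, mul_sub, ← map_mul, ← map_mul,
        inv_mul_cancel, map_one]
    · rw [foxDerivative, map_add, map_smul, ih, foxBoundary_single, lift_mk_cons, cond_true,
        one_mul, smul_eq_mul, mul_sub, mul_one, ← map_mul]
      abel

/-- A group element in the support of a Fox derivative comes from an edge of the path traced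
by the word in the Cayley graph. -/
theorem exists_of_coeff_foxDerivative_ne_zero (x : ι → G) (i : ι) (L : List (ι × Bool)) (g : G)
    (h : (foxDerivative Z x L i).coeff g ≠ 0) :
    ∃ L₁ L₂,
      (L = L₁ ++ (i, true) :: L₂ ∧ FreeGroup.lift x (FreeGroup.mk L₁) = g) ∨
      (L = L₁ ++ (i, false) :: L₂ ∧ FreeGroup.lift x (FreeGroup.mk L₁) * (x i)⁻¹ = g) := by
  classical
  induction L generalizing g with
  | nil => simp [foxDerivative] at h
  | cons p L ih =>
    obtain ⟨j, ε⟩ := p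
    have step : (foxDerivative Z x L i).coeff ((cond ε (x j) (x j)⁻¹)⁻¹ * g) ≠ 0 →
        ∃ L₁ L₂,
          ((j, ε) :: L = L₁ ++ (i, true) :: L₂ ∧ FreeGroup.lift x (FreeGroup.mk L₁) = g) ∨
          ((j, ε) :: L = L₁ ++ (i, false) :: L₂ ∧
            FreeGroup.lift x (FreeGroup.mk L₁) * (x i)⁻¹ = g) := by
      intro h'
      obtain ⟨L₁, L₂, ⟨rfl, h₁⟩ | ⟨rfl, h₁⟩⟩ := ih _ h'
      · exact ⟨(j, ε) :: L₁, L₂, Or.inl ⟨rfl, by rw [lift_mk_cons, h₁, mul_inv_cancel_left]⟩⟩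
      · exact ⟨(j, ε) :: L₁, L₂,
          Or.inr ⟨rfl, by rw [lift_mk_cons, mul_assoc, h₁, mul_inv_cancel_left]⟩⟩
    by_cases h' : (foxDerivative Z x L i).coeff ((cond ε (x j) (x j)⁻¹)⁻¹ * g) = 0
    swap
    · exact step h'
    cases ε
    · simp only [cond_false, inv_inv] at h'
      rw [foxDerivative, Finsupp.smul_apply, smul_eq_mul, MonoidAlgebra.of_apply,
        MonoidAlgebra.coeff_single_mul_apply, one_mul, inv_inv, Finsupp.sub_apply,
        MonoidAlgebra.coeff_sub, Finsupp.sub_apply, h', zero_sub, neg_ne_zero,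
        Finsupp.single_apply] at h
      split_ifs at h with hji
      · subst hji
        rw [MonoidAlgebra.one_def, MonoidAlgebra.coeff_single, Finsupp.single_apply] at h
        split_ifs at h with hg
        · exact ⟨[], L, Or.inr ⟨rfl, by
            simpa [FreeGroup.lift_mk] using inv_eq_of_mul_eq_one_right hg.symm⟩⟩
        · exact absurd rfl h
      · simp at h
    · simp only [cond_true] at h'
      rw [foxDerivative, Finsupp.add_apply, Finsupp.smul_apply, smul_eq_mul,
        MonoidAlgebra.of_apply, MonoidAlgebra.coeff_add, Finsupp.add_apply,
        MonoidAlgebra.coeff_single_mul_apply, one_mul, h', add_zero,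
        Finsupp.single_apply] at h
      split_ifs at h with hji
      · subst hji
        rw [MonoidAlgebra.one_def, MonoidAlgebra.coeff_single, Finsupp.single_apply] at h
        split_ifs at h with hg
        · exact ⟨[], L, Or.inl ⟨rfl, by simpa [FreeGroup.lift_mk] using hg⟩⟩
        · exact absurd rfl h
      · simp at h

theorem eq_nil_of_lift_mk_eq_one [Nontrivial Z] {x : ι → G} (hx : Injective (foxBoundary Z x))
    (n : ℕ) (L : List (ι × Bool)) (hn : L.length ≤ n) (hred : FreeGroup.IsReduced L)
    (h1 : FreeGroup.lift x (FreeGroup.mk L) = 1) : L = [] := by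
  induction n generalizing L with
  | zero => simpa using hn
  | succ n ih =>
    rcases L with _ | ⟨⟨i, ε⟩, L⟩
    · rfl
    exfalso
    have hD : foxDerivative Z x ((i, ε) :: L) = 0 :=
      hx (by rw [foxBoundary_foxDerivative, h1, map_one, sub_self, map_zero])
    have hDi := DFunLike.congr_fun hD i
    simp only [List.length_cons, add_le_add_iff_right] at hn
    cases ε
    · have hc : (foxDerivative Z x L i).coeff 1 ≠ 0 := by
        have h := congrArg (MonoidAlgebra.of Z G (x i) * ·) hDi
        simp only [foxDerivative, Finsupp.smul_apply, smul_eq_mul, ← mul_assoc, ← map_mul,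
          mul_inv_cancel, map_one, one_mul, Finsupp.sub_apply, Finsupp.single_eq_same,
          Finsupp.zero_apply, mul_zero, sub_eq_zero] at h
        simp [h]
      obtain ⟨L₁, L₂, ⟨rfl, h₁⟩ | ⟨rfl, h₁⟩⟩ := exists_of_coeff_foxDerivative_ne_zero x i L 1 hc
      · obtain rfl := ih L₁ (by simp at hn; omega)
          (hred.infix ⟨[(i, false)], (i, true) :: L₂, by simp⟩) h₁
        simp [FreeGroup.isReduced_cons_cons] at hred
      · simpa using ih ((i, false) :: L₁) (by simp at hn ⊢; omega)
          (hred.infix ⟨[], (i, false) :: L₂, by simp⟩)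
          (by rw [lift_mk_cons]; exact mul_eq_one_comm.1 h₁)
    · have hc : (foxDerivative Z x L i).coeff (x i)⁻¹ ≠ 0 := by
        have h := congrArg (fun a : MonoidAlgebra Z G => a.coeff 1) hDi
        simp only [foxDerivative, Finsupp.add_apply, Finsupp.smul_apply, smul_eq_mul,
          Finsupp.single_eq_same, MonoidAlgebra.coeff_add, MonoidAlgebra.of_apply,
          MonoidAlgebra.coeff_single_mul_apply, one_mul, mul_one, MonoidAlgebra.coeff_one_one,
          Finsupp.zero_apply, MonoidAlgebra.coeff_zero] at h
        intro h0
        rw [h0, add_zero] at h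
        exact one_ne_zero h
      obtain ⟨L₁, L₂, ⟨rfl, h₁⟩ | ⟨rfl, h₁⟩⟩ := exists_of_coeff_foxDerivative_ne_zero x i L _ hc
      · simpa using ih ((i, true) :: L₁) (by simp at hn ⊢; omega)
          (hred.infix ⟨[], (i, true) :: L₂, by simp⟩)
          (by rw [lift_mk_cons, h₁]; exact mul_inv_cancel _)
      · obtain rfl := ih L₁ (by simp at hn; omega)
          (hred.infix ⟨[(i, true)], (i, false) :: L₂, by simp⟩) (mul_eq_right.1 h₁)
        simp [FreeGroup.isReduced_cons_cons] at hred

/-- A group is free on generators `x` whose differences `x i - 1` are independent. -/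
theorem nonempty_mulEquiv_freeGroup [Nontrivial Z] {x : ι → G}
    (hgen : Subgroup.closure (Set.range x) = ⊤) (hx : Injective (foxBoundary Z x)) :
    Nonempty (G ≃* FreeGroup ι) := by
  classical
  have hinj : Injective (FreeGroup.lift x) := by
    rw [injective_iff_map_eq_one]
    intro w hw
    rw [← FreeGroup.toWord_eq_nil_iff]
    exact eq_nil_of_lift_mk_eq_one hx _ _ le_rfl FreeGroup.isReduced_toWord
      (by rwa [FreeGroup.mk_toWord])
  have hsurj : Surjective (FreeGroup.lift x) := by
    rw [← MonoidHom.range_eq_top, FreeGroup.range_lift_eq_closure, hgen]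
  exact ⟨(MulEquiv.ofBijective _ ⟨hinj, hsurj⟩).symm⟩

/-- Affine action of a free group whose orbit map at zero is the universal Fox derivation. -/
theorem exists_foxDerivation (e : G ≃* FreeGroup ι) :
    ∃ δ : G → (ι →₀ MonoidAlgebra Z G),
      (∀ g h, δ (g * h) = δ g + MonoidAlgebra.of Z G g • δ h) ∧
      ∀ i, δ (e.symm (FreeGroup.of i)) = Finsupp.single i 1 := by
  let x : ι → G := fun i => e.symm (FreeGroup.of i)
  let σ : ι → Equiv.Perm (ι →₀ MonoidAlgebra Z G) := fun i =>
    { toFun := fun m => Finsupp.single i 1 + MonoidAlgebra.of Z G (x i) • m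
      invFun := fun m => MonoidAlgebra.of Z G (x i)⁻¹ • (m - Finsupp.single i 1)
      left_inv := fun m => by
        simp only [add_sub_cancel_left, smul_smul, ← map_mul, inv_mul_cancel, map_one, one_smul]
      right_inv := fun m => by
        simp only [smul_smul, ← map_mul, mul_inv_cancel, map_one, one_smul, add_sub_cancel] }
  have haff : ∀ w m, FreeGroup.lift σ w m =
      FreeGroup.lift σ w 0 + MonoidAlgebra.of Z G (e.symm w) • m := by
    intro w
    induction w using FreeGroup.induction_on with
    | C1 =>
      intro m
      rw [map_one, map_one, map_one, one_smul, Equiv.Perm.one_apply, Equiv.Perm.one_apply, zero_add]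
    | of i => intro m; simp [σ, x]
    | inv_of i _ =>
      intro m
      rw [map_inv, FreeGroup.lift_apply_of, map_inv]
      change MonoidAlgebra.of Z G (x i)⁻¹ • (m - Finsupp.single i 1) =
        MonoidAlgebra.of Z G (x i)⁻¹ • (0 - Finsupp.single i 1) +
          MonoidAlgebra.of Z G (x i)⁻¹ • m
      rw [← smul_add]
      congr 1
      abel
    | mul v w hv hw =>
      intro m
      rw [map_mul, Equiv.Perm.mul_apply, Equiv.Perm.mul_apply, hv, hw,
        hv (FreeGroup.lift σ w 0), smul_add, map_mul, map_mul, mul_smul, add_assoc]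
  refine ⟨fun g => FreeGroup.lift σ (e g) 0, fun g h => ?_, fun i => ?_⟩
  · change FreeGroup.lift σ (e (g * h)) 0 = _
    rw [map_mul, map_mul, Equiv.Perm.mul_apply, haff, e.symm_apply_apply]
  · simp [σ]

theorem injective_foxBoundary_of_mulEquiv (e : G ≃* FreeGroup ι) :
    Injective (foxBoundary Z fun i => e.symm (FreeGroup.of i)) := by
  obtain ⟨δ, hmul, hgen⟩ := exists_foxDerivation (Z := Z) e
  let Δ : MonoidAlgebra Z G →+ (ι →₀ MonoidAlgebra Z G) :=
    (Finsupp.liftAddHom fun g => (AddMonoidHom.flip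
      (Module.toAddMonoidEnd (MonoidAlgebra Z G) (ι →₀ MonoidAlgebra Z G)).toAddMonoidHom
        (δ g)).comp (MonoidAlgebra.singleAddHom (1 : G))).comp
      (MonoidAlgebra.coeffAddEquiv (R := Z) (M := G)).toAddMonoidHom
  have hΔ : ∀ g z, Δ (MonoidAlgebra.single g z) = MonoidAlgebra.single (1 : G) z • δ g := by
    intro g z
    simp only [Δ, AddMonoidHom.comp_apply]
    exact Finsupp.liftAddHom_apply_single _ _ _ |>.trans rfl
  have key : ∀ i a, Δ (a * (MonoidAlgebra.of Z G (e.symm (FreeGroup.of i)) - 1)) =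
      Finsupp.single i a := by
    intro i a
    induction a using MonoidAlgebra.induction_linear with
    | zero => simp
    | add a b ha hb => rw [add_mul, map_add, ha, hb, Finsupp.single_add]
    | single g z =>
      rw [mul_sub, mul_one, map_sub, MonoidAlgebra.of_apply, MonoidAlgebra.single_mul_single,
        mul_one, hΔ, hΔ, ← smul_sub, hmul, add_sub_cancel_left, hgen, smul_smul,
        MonoidAlgebra.of_apply, MonoidAlgebra.single_mul_single, one_mul, mul_one,
        Finsupp.smul_single, smul_eq_mul, mul_one]
  have hleft : Δ.comp (foxBoundary Z fun i => e.symm (FreeGroup.of i)).toAddMonoidHom =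
      AddMonoidHom.id _ := by
    refine Finsupp.addHom_ext fun i a => ?_
    simpa using key i a
  exact Function.LeftInverse.injective (g := Δ) fun p => DFunLike.congr_fun hleft p

end FoxCalculus

section FirstHomology

variable {G Z U : Type} [Group G] [Ring Z] [Ring U] (φ : MonoidAlgebra Z G →+* U)

/-- The Fox differential after extension of scalars to `U`. -/
noncomputable def inducedFoxBoundary {ι : Type} (x : ι → G) : (ι →₀ U) →ₗ[U] U :=
  Finsupp.linearCombination U fun i => φ (MonoidAlgebra.of Z G (x i) - 1)

theorem inducedFoxBoundary_finsuppInduced {ι : Type} (x : ι → G) (u : U)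
    (q : ι →₀ MonoidAlgebra Z G) :
    inducedFoxBoundary φ x (finsuppInduced φ ι u q) = u * φ (foxBoundary Z x q) := by
  induction q using Finsupp.induction_linear with
  | zero => rw [(isInducedTensor_finsupp φ ι).map_zero]; simp
  | add p q hp hq => rw [(isInducedTensor_finsupp φ ι).2.1, map_add, hp, hq, map_add, map_add,
      mul_add]
  | single i a =>
    rw [finsuppInduced_single, inducedFoxBoundary, Finsupp.linearCombination_single,
      foxBoundary_single, map_mul, smul_eq_mul, mul_assoc]

/-- The first homology computed from the partial resolution attached to a generating family. -/
abbrev FoxHomology {ι : Type} (x : ι → G) : Type :=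
  KernelQuotient (finsuppInduced φ ι) (foxBoundary Z x) (inducedFoxBoundary φ x)

theorem h1OfResolutionPred_iff {ι : Type} {x : ι → G}
    (hx : Subgroup.closure (Set.range x) = ⊤)
    (Pr : (M : Type) → [AddCommGroup M] → [Module U M] → Prop)
    (hPr : ∀ (M N : Type) [AddCommGroup M] [Module U M] [AddCommGroup N] [Module U N],
      (M ≃ₗ[U] N) → Pr M → Pr N) :
    H1OfResolutionPred G Z U φ Pr ↔ Pr (FoxHomology φ x) := by
  have compare : ∀ (P : ℕ → Type) (_ : ∀ k, AddCommGroup (P k))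
      (_ : ∀ k, Module (MonoidAlgebra Z G) (P k)),
      (∀ k, Module.Projective (MonoidAlgebra Z G) (P k)) →
      ∀ (d : ∀ k, P (k + 1) →ₗ[MonoidAlgebra Z G] P k)
        (ε : P 0 →ₗ[MonoidAlgebra Z G] TrivialModule Z G),
        Surjective ε → Exact (d 0) ε → (∀ k, Exact (d (k + 1)) (d k)) →
      ∀ (T : ℕ → Type) (_ : ∀ k, AddCommGroup (T k)) (_ : ∀ k, Module U (T k))
        (b : ∀ k, U → P k → T k), (∀ k, IsInducedTensor φ (b k)) →
      ∀ (D : ∀ k, T (k + 1) →ₗ[U] T k),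
        (∀ k u p, D k (b (k + 1) u p) = b k u (d k p)) →
      Nonempty ((↥(LinearMap.ker (D 0)) ⧸
        Submodule.comap (LinearMap.ker (D 0)).subtype (LinearMap.range (D 1))) ≃ₗ[U]
          FoxHomology φ x) := by
    intro P _ _ hP d ε hε hdε hd T _ _ b hb D hD
    rw [range_eq_kernelSpan (hb 2) (hd 0) (hD 1)]
    have := hP 0
    have := hP 1
    exact nonempty_kernelQuotient_equiv (hb 0) (hb 1) (isInducedTensor_self φ)
      (isInducedTensor_finsupp φ ι) hε surjective_augmentationLinearMap hdε
      (exact_foxBoundary hx) (hD 0) (inducedFoxBoundary_finsuppInduced φ x)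
  constructor
  · intro h
    let X : ModuleCat.{0} (MonoidAlgebra Z G) := ModuleCat.of _ (TrivialModule Z G)
    choose D hD using fun k => (isInducedTensor_finsupp φ (freeSyzygy X (k + 1))).exists_map
      (isInducedTensor_finsupp φ (freeSyzygy X k)) (freeDifferential X k)
    let P : ℕ → Type := fun k => freeSyzygy X k →₀ MonoidAlgebra Z G
    let T : ℕ → Type := fun k => freeSyzygy X k →₀ U
    let ε : P 0 →ₗ[MonoidAlgebra Z G] TrivialModule Z G :=
      Finsupp.linearCombination (MonoidAlgebra Z G) (id : TrivialModule Z G → TrivialModule Z G)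
    have hε : Surjective ε := surjective_linearCombination_id (TrivialModule Z G)
    obtain ⟨f⟩ := compare P inferInstance inferInstance (fun k => inferInstance)
      (freeDifferential X) ε hε (exact_freeDifferential_zero X 0) (exact_freeDifferential X)
      T inferInstance inferInstance (fun k => finsuppInduced φ (freeSyzygy X k))
      (fun k => isInducedTensor_finsupp φ _) D hD
    exact hPr _ _ f (h P inferInstance inferInstance (fun k => inferInstance)
      (freeDifferential X) ε hε (exact_freeDifferential_zero X 0) (exact_freeDifferential X)
      T inferInstance inferInstance (fun k => finsuppInduced φ (freeSyzygy X k))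
      (fun k => isInducedTensor_finsupp φ _) D hD)
  · intro h P i₁ i₂ hP d ε hε hdε hd T i₃ i₄ b hb D hD
    obtain ⟨f⟩ := compare P i₁ i₂ hP d ε hε hdε hd T i₃ i₄ b hb D hD
    exact hPr _ _ f.symm h

theorem inducedFoxBoundary_fin_two (x : Fin 2 → G) (w : Fin 2 →₀ U) :
    inducedFoxBoundary φ x w = w 0 * φ (MonoidAlgebra.of Z G (x 0) - 1) +
      w 1 * φ (MonoidAlgebra.of Z G (x 1) - 1) := by
  rw [inducedFoxBoundary, Finsupp.linearCombination_apply, Finsupp.sum_fintype _ _ (by simp),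
    Fin.sum_univ_two, smul_eq_mul, smul_eq_mul]

theorem nonempty_ker_inducedFoxBoundary_equiv {x : Fin 2 → G}
    (h : IsUnit (φ (MonoidAlgebra.of Z G (x 0) - 1))) :
    Nonempty (↥(LinearMap.ker (inducedFoxBoundary φ x)) ≃ₗ[U] U) := by
  refine ⟨LinearEquiv.ofBijective
    (Finsupp.lapply 1 ∘ₗ (LinearMap.ker (inducedFoxBoundary φ x)).subtype) ⟨?_, fun v => ?_⟩⟩
  · rw [injective_iff_map_eq_zero]
    rintro ⟨w, hw⟩ hw1
    replace hw1 : w 1 = 0 := hw1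
    rw [LinearMap.mem_ker, inducedFoxBoundary_fin_two, hw1, zero_mul, add_zero,
      h.mul_left_eq_zero] at hw
    ext i
    fin_cases i
    · exact hw
    · exact hw1
  · obtain ⟨c, hc⟩ := h
    refine ⟨⟨Finsupp.single 0 (-(v * φ (MonoidAlgebra.of Z G (x 1) - 1) * ↑c⁻¹)) +
      Finsupp.single 1 v, ?_⟩, by simp⟩
    rw [LinearMap.mem_ker, inducedFoxBoundary_fin_two, ← hc]
    simp

theorem foxHomology_equiv_of_injective {x : Fin 2 → G}
    (h : IsUnit (φ (MonoidAlgebra.of Z G (x 0) - 1))) (hinj : Injective (foxBoundary Z x)) :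
    Nonempty (FoxHomology φ x ≃ₗ[U] U) := by
  obtain ⟨f⟩ := nonempty_ker_inducedFoxBoundary_equiv φ h
  refine ⟨(Submodule.quotEquivOfEqBot _ ?_).trans f⟩
  rw [eq_bot_iff]
  rintro w hw
  have hspan : kernelSpan (finsuppInduced φ (Fin 2)) (foxBoundary Z x) = ⊥ := by
    rw [kernelSpan, LinearMap.ker_eq_bot.2 hinj, Submodule.span_eq_bot]
    rintro _ ⟨q, rfl, rfl⟩
    exact (isInducedTensor_finsupp φ _).map_zero 1
  rw [hspan, Submodule.mem_comap, Submodule.mem_bot] at hw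
  exact (Submodule.mem_bot _).2 (Subtype.ext hw)

theorem ker_le_kernelSpan_of_not_injective (hφinj : Injective φ)
    (hunit : ∀ a : MonoidAlgebra Z G, a ≠ 0 → IsUnit (φ a)) {x : Fin 2 → G}
    (h : ¬ Injective (foxBoundary Z x)) :
    LinearMap.ker (inducedFoxBoundary φ x) ≤
      kernelSpan (finsuppInduced φ (Fin 2)) (foxBoundary Z x) := by
  intro w hw
  set c : Fin 2 → MonoidAlgebra Z G := fun i => MonoidAlgebra.of Z G (x i) - 1 with hcdef
  have hmul : ∀ a b : MonoidAlgebra Z G, b ≠ 0 → a * b = 0 → a = 0 := by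
    intro a b hb hab
    have h0 : φ a * φ b = 0 := by rw [← map_mul, hab, map_zero]
    rw [(hunit b hb).mul_left_eq_zero] at h0
    exact hφinj (by rw [h0, map_zero])
  have hsum : ∀ q, foxBoundary Z x q = q 0 * c 0 + q 1 * c 1 := by
    intro q
    rw [foxBoundary, Finsupp.linearCombination_apply, Finsupp.sum_fintype _ _ (by simp),
      Fin.sum_univ_two, smul_eq_mul, smul_eq_mul]
  have hswap : ∀ i j : Fin 2, i ≠ j → ∀ q, foxBoundary Z x q = q i * c i + q j * c j := by
    intro i j hij q
    rw [hsum]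
    fin_cases i <;> fin_cases j <;> simp_all [add_comm]
  have hswapU : ∀ i j : Fin 2, i ≠ j → ∀ q : Fin 2 →₀ U,
      inducedFoxBoundary φ x q = q i * φ (c i) + q j * φ (c j) := by
    intro i j hij q
    rw [inducedFoxBoundary_fin_two]
    fin_cases i <;> fin_cases j <;> simp_all [add_comm]
  have hext : ∀ i j : Fin 2, i ≠ j → ∀ k, k = i ∨ k = j := by decide
  by_cases hc : ∀ i, c i = 0
  · have : w = w 0 • finsuppInduced φ (Fin 2) 1 (Finsupp.single 0 1) +
        w 1 • finsuppInduced φ (Fin 2) 1 (Finsupp.single 1 1) := by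
      ext i
      fin_cases i <;> simp
    rw [this]
    refine add_mem (Submodule.smul_mem _ _ (mem_kernelSpan _ ?_))
      (Submodule.smul_mem _ _ (mem_kernelSpan _ ?_)) <;> simp [hsum, hc]
  · obtain ⟨i, hi⟩ := not_forall.1 hc
    obtain ⟨j, hij⟩ := exists_ne i
    rw [injective_iff_map_eq_zero] at h
    push Not at h
    obtain ⟨κ, hκ, hκ0⟩ := h
    have hκj : κ j ≠ 0 := by
      intro h0
      apply hκ0
      have hκi : κ i = 0 := by
        rw [hswap i j hij.symm, h0, zero_mul, add_zero] at hκ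
        exact hmul _ _ hi hκ
      ext1 k
      rcases hext i j hij.symm k with rfl | rfl
      · exact hκi
      · exact h0
    obtain ⟨u, hu⟩ := hunit _ hκj
    set κ' := finsuppInduced φ (Fin 2) 1 κ with hκ'
    have hκ'E : inducedFoxBoundary φ x κ' = 0 := by
      rw [hκ', inducedFoxBoundary_finsuppInduced, hκ, map_zero, mul_zero]
    have hw' : inducedFoxBoundary φ x (w - (w j * ↑u⁻¹) • κ') = 0 := by
      rw [map_sub, map_smul, hκ'E, smul_zero, sub_zero, LinearMap.mem_ker.1 hw]
    have hj : (w - (w j * ↑u⁻¹) • κ') j = 0 := by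
      simp [hκ', ← hu]
    have hi' : (w - (w j * ↑u⁻¹) • κ') i = 0 := by
      rw [hswapU i j hij.symm, hj, zero_mul, add_zero, (hunit _ hi).mul_left_eq_zero] at hw'
      exact hw'
    have : w = (w j * ↑u⁻¹) • κ' := by
      rw [← sub_eq_zero]
      ext1 k
      rcases hext i j hij.symm k with rfl | rfl
      · exact hi'
      · exact hj
    rw [this]
    exact Submodule.smul_mem _ _ (mem_kernelSpan _ hκ)

theorem injective_foxBoundary_of_nontrivial_foxHomology (hφinj : Injective φ)
    (hunit : ∀ a : MonoidAlgebra Z G, a ≠ 0 → IsUnit (φ a)) {x : Fin 2 → G}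
    (h : Nontrivial (FoxHomology φ x)) : Injective (foxBoundary Z x) := by
  by_contra hinj
  have hle := ker_le_kernelSpan_of_not_injective φ hφinj hunit hinj
  exact Submodule.Quotient.nontrivial_iff.1 h (Submodule.comap_subtype_eq_top.2 hle)

end FirstHomology

/-- Let `Z`, `U` be nonzero rings with `ZG` a subring of `U`
(via an injective ring homomorphism `φ`) such that every nonzero element of
`ZG` becomes invertible in `U`.  The following are equivalent:
(a) `G` is generated by two elements and `H₁(G; U) ≅ U` as left `U`-modules;
(b) `G` is generated by two elements and `H₁(G; U) ≠ 0`;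
(c) `G` is free of rank two. -/
theorem two_generator_H1_iff_free_of_rank_two
    (G Z U : Type) [Group G] [Ring Z] [Ring U] [Nontrivial Z] [Nontrivial U]
    (φ : MonoidAlgebra Z G →+* U) (hφinj : Function.Injective φ)
    (hunit : ∀ a : MonoidAlgebra Z G, a ≠ 0 → IsUnit (φ a)) :
    (((∃ x y : G, Subgroup.closure ({x, y} : Set G) = ⊤) ∧
        H1OfResolutionPred G Z U φ (fun M _ _ => Nonempty (M ≃ₗ[U] U))) ↔
      Nonempty (G ≃* FreeGroup (Fin 2))) ∧
    (((∃ x y : G, Subgroup.closure ({x, y} : Set G) = ⊤) ∧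
        H1OfResolutionPred G Z U φ (fun M _ _ => Nontrivial M)) ↔
      Nonempty (G ≃* FreeGroup (Fin 2))) := by
  have free_of_nontrivial : (∃ x y : G, Subgroup.closure ({x, y} : Set G) = ⊤) →
      H1OfResolutionPred G Z U φ (fun M _ _ => Nontrivial M) →
      Nonempty (G ≃* FreeGroup (Fin 2)) := by
    rintro ⟨x, y, hxy⟩ h
    have hgen : Subgroup.closure (Set.range ![x, y]) = ⊤ := by
      rwa [Matrix.range_cons_cons_empty]
    exact nonempty_mulEquiv_freeGroup hgen (injective_foxBoundary_of_nontrivial_foxHomology φ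
      hφinj hunit ((h1OfResolutionPred_iff φ hgen _
        fun M _ _ _ _ _ f (_ : Nontrivial M) => f.symm.toEquiv.nontrivial).1 h))
  have homology_of_free : Nonempty (G ≃* FreeGroup (Fin 2)) →
      (∃ x y : G, Subgroup.closure ({x, y} : Set G) = ⊤) ∧
        H1OfResolutionPred G Z U φ (fun M _ _ => Nonempty (M ≃ₗ[U] U)) := by
    rintro ⟨e⟩
    have hgen : Subgroup.closure (Set.range fun i => e.symm (FreeGroup.of i)) = ⊤ := by
      have h := congrArg (Subgroup.map e.symm.toMonoidHom) (FreeGroup.closure_range_of (Fin 2))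
      rw [MonoidHom.map_closure, ← Set.range_comp,
        Subgroup.map_top_of_surjective _ e.symm.surjective] at h
      exact h
    refine ⟨⟨e.symm (FreeGroup.of 0), e.symm (FreeGroup.of 1), ?_⟩, ?_⟩
    · rw [← hgen]
      congr 1
      ext g
      simp [Fin.exists_fin_two, eq_comm]
    · refine (h1OfResolutionPred_iff φ hgen _ fun M N _ _ _ _ f ⟨g⟩ => ⟨f.symm.trans g⟩).2
        (foxHomology_equiv_of_injective φ (hunit _ ?_) (injective_foxBoundary_of_mulEquiv e))
      rw [sub_ne_zero, ← map_one (MonoidAlgebra.of Z G)]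
      intro h
      have h1 := MonoidAlgebra.of_injective h
      rw [e.symm.map_eq_one_iff] at h1
      exact FreeGroup.of_ne_one 0 h1
  have nontrivial_of_equiv : H1OfResolutionPred G Z U φ (fun M _ _ => Nonempty (M ≃ₗ[U] U)) →
      H1OfResolutionPred G Z U φ (fun M _ _ => Nontrivial M) := by
    intro h P i₁ i₂ hP d ε hε hdε hd T i₃ i₄ b hb D hD
    obtain ⟨f⟩ := h P i₁ i₂ hP d ε hε hdε hd T i₃ i₄ b hb D hD
    exact f.toEquiv.nontrivial
  exact ⟨⟨fun h => free_of_nontrivial h.1 (nontrivial_of_equiv h.2), homology_of_free⟩,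
    ⟨fun h => free_of_nontrivial h.1 h.2,
      fun h => ⟨(homology_of_free h).1, nontrivial_of_equiv (homology_of_free h).2⟩⟩⟩
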